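/- Let 𝒜 be a unital C*-algebra admitting a faithful tracial state τ. Then 𝒜 is stably finite: for every n ∈ ℕ and all A, B ∈ M_n(𝒜), if AB = 1 in M_n(𝒜) then BA = 1 in M_n(𝒜). -/

import Mathlib

/-- `τ` is a faithful tracial state on the unital C⋆-algebra `A`:
a linear functional with `τ 1 = 1`, `τ (a* a) ≥ 0`, `τ (a b) = τ (b a)`, and
`τ (a* a) = 0 → a = 0`. -/
structure IsFaithfulTracialState (A : Type*) [CStarAlgebra A] (τ : A → ℂ) : Prop where
  map_add : ∀ a b, τ (a + b) = τ a + τ b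
  map_smul : ∀ (c : ℂ) a, τ (c • a) = c * τ a
  map_one : τ 1 = 1
  nonneg_re : ∀ a, 0 ≤ (τ (star a * a)).re
  im_eq_zero : ∀ a, (τ (star a * a)).im = 0
  tracial : ∀ a b, τ (a * b) = τ (b * a)
  faithful : ∀ a, τ (star a * a) = 0 → a = 0

/-- If `x * y = 1` in a unital C⋆-algebra, then `star y * y` is invertible. -/
theorem isUnit_star_mul_self_of_mul_eq_one {B : Type*} [CStarAlgebra B] {x y : B}
    (hxy : x * y = 1) : IsUnit (star y * y) := by
  let _ := CStarAlgebra.spectralOrder B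
  have := CStarAlgebra.spectralOrderedRing B
  have hle : (1 : B) ≤ ‖star x * x‖ • (star y * y) := by
    calc (1 : B) = star y * (star x * x) * y := by
          rw [← mul_assoc, ← star_mul, hxy, mul_assoc, hxy, star_one, one_mul]
      _ ≤ ‖star x * x‖ • (star y * y) :=
          CStarAlgebra.star_left_conjugate_le_norm_smul (.star_mul_self x)
  have hu : IsUnit (‖star x * x‖ • (star y * y)) := CStarAlgebra.isUnit_of_le 1 hle
  rw [← smul_one_mul] at hu
  exact ((Commute.one_left _).smul_left _ |>.isUnit_mul_iff.mp hu).2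

/-- A unital C⋆-algebra with a faithful additive tracial functional is Dedekind-finite. -/
theorem mul_eq_one_symm_of_faithful_trace {B G : Type*} [CStarAlgebra B] [AddGroup G]
    (f : B →+ G) (htr : ∀ a b, f (a * b) = f (b * a)) (hf : ∀ a, f (star a * a) = 0 → a = 0)
    {x y : B} (hxy : x * y = 1) : y * x = 1 := by
  obtain ⟨u, hu⟩ := isUnit_star_mul_self_of_mul_eq_one hxy
  set h : B := ↑u⁻¹ with hh
  have hl : h * (star y * y) = 1 := by rw [← hu, hh, Units.inv_mul]
  have hr : star y * y * h = 1 := by rw [← hu, hh, Units.mul_inv]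
  have hsa : star h = h := by
    refine left_inv_eq_right_inv (a := star y * y) ?_ hr
    simpa using congrArg star hr
  have hp : star (1 - y * h * star y) * (1 - y * h * star y) = 1 - y * h * star y := by
    have hpp : y * h * star y * (y * h * star y) = y * h * star y := by
      calc _ = y * (h * (star y * y)) * h * star y := by simp only [mul_assoc]
        _ = _ := by rw [hl, mul_one]
    have hs : star (y * h * star y) = y * h * star y := by
      simp [hsa, mul_assoc]
    rw [star_sub, star_one, hs, mul_sub, sub_mul, sub_mul, hpp]
    simp
  have h0 : 1 - y * h * star y = 0 := by
    apply hf
    rw [hp, map_sub, mul_assoc, htr, mul_assoc, hl, sub_self]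
  have hy : y * (h * star y) = 1 := by rw [← mul_assoc]; exact (sub_eq_zero.mp h0).symm
  rwa [left_inv_eq_right_inv hxy hy]

namespace IsFaithfulTracialState

variable {A : Type*} [CStarAlgebra A] {τ : A → ℂ}

/-- The trace on matrices over `A` induced by `τ`. -/
def matrixTrace (hτ : IsFaithfulTracialState A τ) (n : ℕ) : CStarMatrix (Fin n) (Fin n) A →+ ℂ :=
  AddMonoidHom.mk' (fun M => ∑ i, τ (M i i)) fun M N => by
    simp [hτ.map_add, Finset.sum_add_distrib]

theorem map_sum (hτ : IsFaithfulTracialState A τ) {ι : Type*} (s : Finset ι) (g : ι → A) :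
    τ (∑ i ∈ s, g i) = ∑ i ∈ s, τ (g i) :=
  _root_.map_sum (AddMonoidHom.mk' τ hτ.map_add) g s

theorem matrixTrace_mul (hτ : IsFaithfulTracialState A τ) {n : ℕ}
    (M N : CStarMatrix (Fin n) (Fin n) A) :
    hτ.matrixTrace n (M * N) = ∑ i, ∑ j, τ (M i j * N j i) := by
  simp [matrixTrace, CStarMatrix.mul_apply, hτ.map_sum]

theorem matrixTrace_mul_comm (hτ : IsFaithfulTracialState A τ) {n : ℕ}
    (M N : CStarMatrix (Fin n) (Fin n) A) :
    hτ.matrixTrace n (M * N) = hτ.matrixTrace n (N * M) := by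
  rw [matrixTrace_mul, matrixTrace_mul, Finset.sum_comm]
  simp_rw [hτ.tracial (M _ _)]

theorem eq_zero_of_matrixTrace_eq_zero (hτ : IsFaithfulTracialState A τ) {n : ℕ}
    (M : CStarMatrix (Fin n) (Fin n) A) (hM : hτ.matrixTrace n (star M * M) = 0) : M = 0 := by
  rw [matrixTrace_mul] at hM
  simp only [CStarMatrix.star_apply] at hM
  have hre := congrArg Complex.re hM
  simp only [Complex.re_sum, Complex.zero_re] at hre
  ext i j
  have hj := (Finset.sum_eq_zero_iff_of_nonneg fun k _ =>
    Finset.sum_nonneg fun l _ => hτ.nonneg_re (M l k)).mp hre j (Finset.mem_univ j)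
  have hij := (Finset.sum_eq_zero_iff_of_nonneg fun l _ =>
    hτ.nonneg_re (M l j)).mp hj i (Finset.mem_univ i)
  exact hτ.faithful _ (Complex.ext hij (hτ.im_eq_zero _))

end IsFaithfulTracialState

/-- A unital C⋆-algebra admitting a faithful tracial state is stably finite: for every `n`,
one-sided inverses in `Mₙ(A)` are two-sided. -/
theorem stmt11 (A : Type*) [CStarAlgebra A] (τ : A → ℂ)
    (hτ : IsFaithfulTracialState A τ) :
    ∀ (n : ℕ) (M N : Matrix (Fin n) (Fin n) A), M * N = 1 → N * M = 1 := by
  intro n M N hMN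
  let _ := CStarAlgebra.spectralOrder A
  have := CStarAlgebra.spectralOrderedRing A
  exact mul_eq_one_symm_of_faithful_trace (B := CStarMatrix (Fin n) (Fin n) A)
    (hτ.matrixTrace n) hτ.matrixTrace_mul_comm hτ.eq_zero_of_matrixTrace_eq_zero hMN
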